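/- For every function f : {0,1}^n → {0,1}, it holds that ldeg_+(f) ≤ 16 · deg_sos(f)^3. (This is the polynomial-degree form of the statement that for Boolean-valued functions, randomized query complexity in expectation is at most 16 times the cube of quantum query complexity in expectation.) -/

import Mathlib

/-- The Boolean point `x ∈ {0,1}ⁿ` viewed as a real vector. -/
def b2r {n : ℕ} (x : Fin n → Bool) : Fin n → ℝ := fun i => if x i then 1 else 0

/-- `f : {0,1}ⁿ → ℝ` agrees on the Boolean cube with a nonnegative literal polynomial of
degree at most `d`. -/
def HasLitDeg (n d : ℕ) (f : (Fin n → Bool) → ℝ) : Prop :=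
  ∃ (m : ℕ) (α : Fin m → ℝ) (S : Fin m → Finset (Fin n)) (b : Fin m → Fin n → Bool),
    (∀ j, 0 ≤ α j) ∧ (∀ j, α j ≠ 0 → (S j).card ≤ d) ∧
    ∀ x, f x = ∑ j, α j * ∏ i ∈ S j, (if b j i then b2r x i else 1 - b2r x i)

/-- The nonnegative literal degree `ldeg₊(f)`. -/
noncomputable def ldegPos (n : ℕ) (f : (Fin n → Bool) → ℝ) : ℕ :=
  sInf {d | HasLitDeg n d f}

/-- `f : {0,1}ⁿ → ℝ` has sum-of-squares degree at most `d`. -/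
def HasSosDeg (n d : ℕ) (f : (Fin n → Bool) → ℝ) : Prop :=
  ∃ (m : ℕ) (p : Fin m → MvPolynomial (Fin n) ℝ),
    (∀ i, (p i).totalDegree ≤ d) ∧
    ∀ x, f x = ∑ i, (MvPolynomial.eval (b2r x) (p i)) ^ 2

/-- The sum-of-squares degree `deg_sos(f)`. -/
noncomputable def degSos (n : ℕ) (f : (Fin n → Bool) → ℝ) : ℕ :=
  sInf {d | HasSosDeg n d f}

open Polynomial in
/-- Endpoint Markov inequality, on `[0,1]`. -/
lemma endpoint_markov (D : ℕ) (p : ℝ[X]) (hd : p.degree ≤ D)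
    (hb : ∀ t ∈ Set.Icc (0:ℝ) 1, p.eval t ∈ Set.Icc (0:ℝ) 1) :
    |p.derivative.eval 0| ≤ (D:ℝ) ^ 2 := by
  have key : ∀ s : ℝ, (s = 1 ∨ s = -1) → s * p.derivative.eval 0 ≤ (D:ℝ) ^ 2 := by
    intro s hs
    set Q : ℝ[X] := C (-s) * (2 * p.comp (C (1/2) - C (1/2) * X) - 1) with hQ
    have hdeg : Q.degree ≤ D := by
      have h0 : (p.comp (C (1/2) - C (1/2) * X)).natDegree ≤ D := by
        refine natDegree_comp_le.trans ?_
        have h1 : (C (1/2:ℝ) - C (1/2) * X).natDegree ≤ 1 := by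
          compute_degree
        have h2 : p.natDegree ≤ D := natDegree_le_of_degree_le hd
        nlinarith
      apply degree_le_of_natDegree_le
      rw [hQ]
      refine (natDegree_C_mul_le _ _).trans ?_
      refine (natDegree_sub_le _ _).trans ?_
      have h3 : (2 * p.comp (C (1/2) - C (1/2) * X)).natDegree ≤ D := by
        have : (2 : ℝ[X]) = C 2 := rfl
        rw [this]
        exact (natDegree_C_mul_le _ _).trans h0
      rw [natDegree_one]
      exact max_le h3 (Nat.zero_le _)
    have hbd : ∀ x ∈ Set.Icc (-1:ℝ) 1, |Q.eval x| ≤ 1 := by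
      intro x hx
      obtain ⟨h1, h2⟩ := hb (1/2 - 1/2 * x) ⟨by linarith [hx.2], by linarith [hx.1]⟩
      have : Q.eval x = -s * (2 * p.eval (1/2 - 1/2*x) - 1) := by
        simp [hQ, eval_comp]
      rw [this, abs_le]
      rcases hs with rfl | rfl <;> constructor <;> linarith
    have := Chebyshev.eval_iterate_derivative_le_of_forall_abs_le_one (k := 1) (le_refl (1:ℝ)) hdeg hbd
    have h5 : (derivative Q).eval 1 = s * p.derivative.eval 0 := by
      simp [hQ, derivative_comp, eval_comp]
    rw [Function.iterate_one, h5] at this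
    have h6 := Chebyshev.derivative_T_eval_one (R := ℝ) (D:ℤ)
    rw [h6] at this
    simpa using this
  rw [abs_le]
  constructor
  · linarith [key (-1) (Or.inr rfl)]
  · linarith [key 1 (Or.inl rfl)]

/-- Monomials as functions on the cube. -/
def chi {n : ℕ} (S : Finset (Fin n)) : (Fin n → Bool) → ℝ := fun x => ∏ i ∈ S, b2r x i

/-- Functions of degree at most `D`. -/
def PD (n D : ℕ) : Submodule ℝ ((Fin n → Bool) → ℝ) :=
  Submodule.span ℝ {g | ∃ S : Finset (Fin n), S.card ≤ D ∧ g = chi S}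

lemma chi_mem {n D : ℕ} {S : Finset (Fin n)} (h : S.card ≤ D) : chi S ∈ PD n D :=
  Submodule.subset_span ⟨S, h, rfl⟩

lemma b2r_sq {n : ℕ} (x : Fin n → Bool) (i : Fin n) : b2r x i * b2r x i = b2r x i := by
  unfold b2r; split_ifs <;> simp

lemma chi_apply {n : ℕ} (S : Finset (Fin n)) (x : Fin n → Bool) :
    chi S x = if ∀ i ∈ S, x i = true then 1 else 0 := by
  unfold chi b2r
  rw [Finset.prod_ite_zero]
  simp

lemma chi_mul {n : ℕ} (S T : Finset (Fin n)) : chi S * chi T = chi (S ∪ T) := by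
  ext x
  simp only [Pi.mul_apply, chi_apply]
  by_cases h1 : ∀ i ∈ S, x i = true <;> by_cases h2 : ∀ i ∈ T, x i = true
  · rw [if_pos h1, if_pos h2, if_pos (by intro i hi; rcases Finset.mem_union.1 hi with h | h; exacts [h1 i h, h2 i h])]
    simp
  · rw [if_neg h2, if_neg (c := ∀ i ∈ S ∪ T, x i = true) (fun h => h2 fun i hi => h i (Finset.mem_union_right _ hi))]; simp
  · rw [if_neg h1, if_neg (c := ∀ i ∈ S ∪ T, x i = true) (fun h => h1 fun i hi => h i (Finset.mem_union_left _ hi))]; simp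
  · rw [if_neg h1, if_neg (c := ∀ i ∈ S ∪ T, x i = true) (fun h => h1 fun i hi => h i (Finset.mem_union_left _ hi))]; simp

lemma PD_mono {n D E : ℕ} (h : D ≤ E) : PD n D ≤ PD n E := by
  apply Submodule.span_mono
  rintro g ⟨S, hS, rfl⟩
  exact ⟨S, hS.trans h, rfl⟩

lemma one_mem_PD {n D : ℕ} : (1 : (Fin n → Bool) → ℝ) ∈ PD n D := by
  have : (1 : (Fin n → Bool) → ℝ) = chi ∅ := by ext x; simp [chi]
  rw [this]; exact chi_mem (by simp)

lemma PD_mul {n D E : ℕ} {f g : (Fin n → Bool) → ℝ} (hf : f ∈ PD n D) (hg : g ∈ PD n E) :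
    f * g ∈ PD n (D + E) := by
  induction hf using Submodule.span_induction with
  | mem f hf =>
    obtain ⟨S, hS, rfl⟩ := hf
    induction hg using Submodule.span_induction with
    | mem g hg =>
      obtain ⟨T, hT, rfl⟩ := hg
      rw [chi_mul]
      exact chi_mem ((Finset.card_union_le _ _).trans (by omega))
    | zero => rw [mul_zero]; exact zero_mem _
    | add a b _ _ ha hb => rw [mul_add]; exact add_mem ha hb
    | smul c a _ ha => rw [mul_smul_comm]; exact Submodule.smul_mem _ _ ha
  | zero => rw [zero_mul]; exact zero_mem _
  | add a b _ _ ha hb => rw [add_mul]; exact add_mem ha hb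
  | smul c a _ ha => rw [smul_mul_assoc]; exact Submodule.smul_mem _ _ ha

lemma PD_pow {n D : ℕ} {f : (Fin n → Bool) → ℝ} (hf : f ∈ PD n D) (k : ℕ) :
    f ^ k ∈ PD n (k * D) := by
  induction k with
  | zero => rw [pow_zero]; exact one_mem_PD
  | succ k ih => rw [pow_succ, Nat.succ_mul]; exact PD_mul ih hf

lemma PD_prod {n : ℕ} {ι : Type*} (s : Finset ι) (e : ι → ℕ) (f : ι → (Fin n → Bool) → ℝ)
    (hf : ∀ i ∈ s, f i ∈ PD n (e i)) : ∏ i ∈ s, f i ∈ PD n (∑ i ∈ s, e i) := by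
  classical
  induction s using Finset.induction_on with
  | empty => simpa using one_mem_PD
  | insert a s ha ih =>
    rw [Finset.prod_insert ha, Finset.sum_insert ha]
    exact PD_mul (hf a (by simp)) (ih fun i hi => hf i (by simp [hi]))

lemma coord_mem {n : ℕ} (i : Fin n) : (fun x => b2r x i) ∈ PD n 1 := by
  have : (fun x : Fin n → Bool => b2r x i) = chi {i} := by ext x; simp [chi]
  rw [this]; exact chi_mem (by simp)

/-- Composition with coordinatewise degree-one substitutions. -/
lemma PD_comp {n m D : ℕ} {F : (Fin n → Bool) → ℝ} (hF : F ∈ PD n D)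
    (φ : (Fin m → Bool) → (Fin n → Bool)) (hφ : ∀ i, (fun y => b2r (φ y) i) ∈ PD m 1) :
    (fun y => F (φ y)) ∈ PD m D := by
  induction hF using Submodule.span_induction with
  | mem f hf =>
    obtain ⟨S, hS, rfl⟩ := hf
    have h1 := PD_prod S (fun _ => 1) (fun i y => b2r (φ y) i) (fun i _ => hφ i)
    have h2 : (fun y => chi S (φ y)) = ∏ i ∈ S, (fun y => b2r (φ y) i) := by
      ext y; simp [chi]
    rw [h2]
    exact PD_mono (by simpa using hS) h1
  | zero => exact zero_mem _
  | add a b _ _ ha hb => exact add_mem ha hb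
  | smul c a _ ha => exact Submodule.smul_mem _ c ha

lemma eval_mem_PD {n d : ℕ} (p : MvPolynomial (Fin n) ℝ) (hp : p.totalDegree ≤ d) :
    (fun x => MvPolynomial.eval (b2r x) p) ∈ PD n d := by
  have : (fun x : Fin n → Bool => MvPolynomial.eval (b2r x) p) =
      ∑ m ∈ p.support, p.coeff m • ∏ i, (fun x : Fin n → Bool => b2r x i) ^ (m i) := by
    ext x
    rw [MvPolynomial.eval_eq']
    simp
  rw [this]
  refine sum_mem fun m hm => Submodule.smul_mem _ _ ?_
  refine PD_mono ?_ (PD_prod Finset.univ (fun i => m i * 1) _ (fun i _ => PD_pow (coord_mem i) (m i)))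
  have := MvPolynomial.le_totalDegree hm
  rw [Finsupp.sum_fintype _ _ (by simp)] at this
  simpa using this.trans hp

/-- Expectation of `G` under the product distribution with bias `X`. -/
noncomputable def biasPoly (b : ℕ) : ((Fin b → Bool) → ℝ) →ₗ[ℝ] Polynomial ℝ where
  toFun G := ∑ y, G y • ∏ i, (if y i then Polynomial.X else 1 - Polynomial.X)
  map_add' G H := by simp [add_smul, Finset.sum_add_distrib]
  map_smul' c G := by simp [mul_smul, Finset.smul_sum]

lemma biasPoly_chi {b : ℕ} (S : Finset (Fin b)) : biasPoly b (chi S) = Polynomial.X ^ S.card := by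
  have h : ∀ y : Fin b → Bool, chi S y • ∏ i, (if y i then (Polynomial.X : Polynomial ℝ) else 1 - Polynomial.X)
      = ∏ i, (if y i then Polynomial.X else if i ∈ S then 0 else 1 - Polynomial.X) := by
    intro y
    rw [chi_apply]
    split_ifs with h
    · rw [one_smul]
      refine Finset.prod_congr rfl fun i _ => ?_
      by_cases hi : i ∈ S
      · simp [h i hi]
      · simp [hi]
    · push Not at h
      obtain ⟨i, hi, hy⟩ := h
      rw [zero_smul]
      symm
      exact Finset.prod_eq_zero (Finset.mem_univ i) (by simp [hi, hy])
  have h2 := Finset.prod_univ_sum (fun _ : Fin b => (Finset.univ : Finset Bool))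
    (fun i z => (if z then (Polynomial.X : Polynomial ℝ) else if i ∈ S then 0 else 1 - Polynomial.X))
  rw [Fintype.piFinset_univ] at h2
  change ∑ y, chi S y • _ = _
  rw [Finset.sum_congr rfl (fun y _ => h y), ← h2]
  have h3 : ∀ i : Fin b, ∑ z : Bool, (if z then (Polynomial.X : Polynomial ℝ) else if i ∈ S then 0 else 1 - Polynomial.X)
      = if i ∈ S then Polynomial.X else 1 := by
    intro i
    by_cases hi : i ∈ S <;> simp [hi]
  rw [Finset.prod_congr rfl (fun i _ => h3 i), Finset.prod_ite_mem]
  simp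

lemma biasPoly_degree {b D : ℕ} {G : (Fin b → Bool) → ℝ} (hG : G ∈ PD b D) :
    (biasPoly b G).degree ≤ D := by
  rw [← Polynomial.mem_degreeLE]
  induction hG using Submodule.span_induction with
  | mem f hf =>
    obtain ⟨S, hS, rfl⟩ := hf
    rw [biasPoly_chi, Polynomial.mem_degreeLE]
    refine (Polynomial.degree_X_pow_le _).trans ?_
    exact_mod_cast hS
  | zero => rw [map_zero]; exact zero_mem _
  | add a b _ _ ha hb => rw [map_add]; exact add_mem ha hb
  | smul c a _ ha => rw [map_smul]; exact Submodule.smul_mem _ _ ha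

lemma biasPoly_deriv {b D : ℕ} {G : (Fin b → Bool) → ℝ} (hG : G ∈ PD b D) :
    (biasPoly b G).derivative.eval 0 =
      ∑ i, (G (fun j => decide (j = i)) - G (fun _ => false)) := by
  induction hG using Submodule.span_induction with
  | mem f hf =>
    obtain ⟨S, hS, rfl⟩ := hf
    rw [biasPoly_chi]
    simp only [chi_apply]
    rcases Nat.lt_trichotomy S.card 1 with h | h | h
    · have : S = ∅ := by rw [← Finset.card_eq_zero]; omega
      subst this; simp
    · obtain ⟨a, rfl⟩ := Finset.card_eq_one.1 h
      simp
    · have h1 : ∀ i, ¬ ∀ j ∈ S, decide (j = i) = true := by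
        intro i hi
        have : S ⊆ {i} := fun j hj => by simpa using hi j hj
        have := Finset.card_le_card this
        simp at this; omega
      have h2 : ¬ ∀ j ∈ S, false = true := by
        obtain ⟨j, hj⟩ := Finset.card_pos.1 (by omega : 0 < S.card)
        intro hh; simpa using hh j hj
      rw [Finset.sum_congr rfl (fun i _ => by rw [if_neg (h1 i), if_neg h2])]
      have h3 : S.card - 1 ≠ 0 := by omega
      simp [Polynomial.derivative_X_pow, h3]
  | zero => simp
  | add a b _ _ ha hb =>
    rw [map_add, Polynomial.derivative_add, Polynomial.eval_add, ha, hb, ← Finset.sum_add_distrib]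
    refine Finset.sum_congr rfl fun i _ => ?_
    simp only [Pi.add_apply]; ring
  | smul c a _ ha =>
    rw [map_smul, Polynomial.derivative_smul, Polynomial.eval_smul, ha, Finset.smul_sum]
    refine Finset.sum_congr rfl fun i _ => ?_
    simp only [Pi.smul_apply, smul_eq_mul]; ring

lemma biasPoly_eval {b : ℕ} {G : (Fin b → Bool) → ℝ} (hG : ∀ y, G y ∈ Set.Icc (0:ℝ) 1)
    (t : ℝ) (ht : t ∈ Set.Icc (0:ℝ) 1) : (biasPoly b G).eval t ∈ Set.Icc (0:ℝ) 1 := by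
  have he : ∀ H : (Fin b → Bool) → ℝ, (biasPoly b H).eval t = ∑ y, H y * ∏ i, (if y i then t else 1 - t) := by
    intro H
    change (∑ y, H y • _ : Polynomial ℝ).eval t = _
    rw [Polynomial.eval_finsetSum]
    refine Finset.sum_congr rfl fun y _ => ?_
    rw [Polynomial.eval_smul, Polynomial.eval_prod, smul_eq_mul]
    congr 1
    refine Finset.prod_congr rfl fun i _ => ?_
    split_ifs <;> simp
  have hw : ∀ y : Fin b → Bool, 0 ≤ ∏ i, (if y i then t else 1 - t) := fun y =>
    Finset.prod_nonneg fun i _ => by split_ifs; exacts [ht.1, by linarith [ht.2]]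
  have h1 := he (chi ∅)
  rw [biasPoly_chi] at h1
  simp [chi] at h1
  rw [he]
  constructor
  · exact Finset.sum_nonneg fun y _ => mul_nonneg (hG y).1 (hw y)
  · refine le_trans ?_ h1.symm.le
    exact Finset.sum_le_sum fun y _ => mul_le_of_le_one_left (hw y) (hG y).2

/-- Flip the bits of `x` in `B`. -/
def flip' {n : ℕ} (x : Fin n → Bool) (B : Finset (Fin n)) : Fin n → Bool :=
  fun i => if i ∈ B then !(x i) else x i

/-- `x` has `b` disjoint sensitive blocks. -/
def HasBlocks {n : ℕ} (F : (Fin n → Bool) → ℝ) (x : Fin n → Bool) (b : ℕ) : Prop :=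
  ∃ B : Fin b → Finset (Fin n), (∀ i j, i ≠ j → Disjoint (B i) (B j)) ∧
    ∀ i, F (flip' x (B i)) ≠ F x

lemma blocks_le {n D b : ℕ} {F : (Fin n → Bool) → ℝ} (hF : F ∈ PD n D)
    (h01 : ∀ x, F x = 0 ∨ F x = 1) {x : Fin n → Bool} (hb : HasBlocks F x b) : b ≤ D ^ 2 := by
  obtain ⟨B, hdis, hsens⟩ := hb
  classical
  let φ : (Fin b → Bool) → (Fin n → Bool) := fun y i =>
    if ∃ j, i ∈ B j ∧ y j = true then !(x i) else x i
  have hφ : ∀ i, (fun y => b2r (φ y) i) ∈ PD b 1 := by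
    intro i
    by_cases hi : ∃ j, i ∈ B j
    · obtain ⟨j, hj⟩ := hi
      have hu : ∀ y : Fin b → Bool, (∃ j, i ∈ B j ∧ y j = true) ↔ y j = true := by
        intro y
        constructor
        · rintro ⟨k, hk, hy⟩
          by_cases hkj : k = j
          · rwa [← hkj]
          · exact absurd hj (Finset.disjoint_left.1 (hdis k j hkj) hk)
        · exact fun h => ⟨j, hj, h⟩
      cases hx : x i
      · have : (fun y => b2r (φ y) i) = (fun y => b2r y j) := by
          ext y; simp only [b2r, φ, hu]; by_cases h : y j = true <;> simp [h, hx]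
        rw [this]; exact coord_mem j
      · have : (fun y => b2r (φ y) i) = 1 - (fun y => b2r y j) := by
          ext y; simp only [b2r, φ, hu, Pi.sub_apply, Pi.one_apply]
          by_cases h : y j = true <;> simp [h, hx]
        rw [this]; exact sub_mem one_mem_PD (coord_mem j)
    · have : (fun y => b2r (φ y) i) = (b2r x i) • (1 : (Fin b → Bool) → ℝ) := by
        ext y
        have : ¬ ∃ j, i ∈ B j ∧ y j = true := fun ⟨j, hj, _⟩ => hi ⟨j, hj⟩
        simp [b2r, φ, this]
      rw [this]; exact Submodule.smul_mem _ _ one_mem_PD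
  have hG := PD_comp hF φ hφ
  have hm := endpoint_markov D _ (biasPoly_degree hG) (biasPoly_eval (fun y => by
    rcases h01 (φ y) with h | h <;> simp [h]))
  rw [biasPoly_deriv hG] at hm
  have h0 : φ (fun _ => false) = x := by ext i; simp [φ]
  have h1 : ∀ j, φ (fun k => decide (k = j)) = flip' x (B j) := by
    intro j; ext i; simp [φ, flip']
  simp only [h0, h1] at hm
  have hreal : (b:ℝ) ≤ (D:ℝ) ^ 2 := by
    rcases h01 x with hx | hx
    · have : ∀ j, F (flip' x (B j)) - F x = 1 := by
        intro j
        rcases h01 (flip' x (B j)) with h | h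
        · exact absurd (h.trans hx.symm) (hsens j)
        · rw [h, hx]; norm_num
      simp only [this] at hm
      simpa using hm
    · have : ∀ j, F (flip' x (B j)) - F x = -1 := by
        intro j
        rcases h01 (flip' x (B j)) with h | h
        · rw [h, hx]; norm_num
        · exact absurd (h.trans hx.symm) (hsens j)
      simp only [this] at hm
      simpa using hm
  exact_mod_cast hreal

lemma PD_coeff {n D : ℕ} {F : (Fin n → Bool) → ℝ} (hF : F ∈ PD n D) :
    ∃ c : Finset (Fin n) → ℝ, (∀ S, c S ≠ 0 → S.card ≤ D) ∧ F = ∑ S, c S • chi S := by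
  classical
  induction hF using Submodule.span_induction with
  | mem f hf =>
    obtain ⟨S, hS, rfl⟩ := hf
    refine ⟨fun T => if T = S then 1 else 0, ?_, ?_⟩
    · intro T hT
      have : T = S := by by_contra h; simp [h] at hT
      rw [this]; exact hS
    · simp
  | zero => exact ⟨0, by simp, by simp⟩
  | add a b _ _ ha hb =>
    obtain ⟨c, hc, rfl⟩ := ha
    obtain ⟨e, he, rfl⟩ := hb
    refine ⟨c + e, ?_, ?_⟩
    · intro S hS
      by_cases h : c S = 0
      · exact he S (by simpa [h] using hS)
      · exact hc S h
    · simp [add_smul, Finset.sum_add_distrib]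
  | smul r a _ ha =>
    obtain ⟨c, hc, rfl⟩ := ha
    refine ⟨r • c, ?_, ?_⟩
    · intro S hS
      exact hc S (fun h => hS (by simp [h]))
    · simp [mul_smul, Finset.smul_sum]

/-- Overwrite `x` on `M` by `a`. -/
def ov {n : ℕ} (M : Finset (Fin n)) (a x : Fin n → Bool) : Fin n → Bool :=
  fun i => if i ∈ M then a i else x i

lemma alt_sum_zero {n : ℕ} (M : Finset (Fin n)) (i : Fin n) (hi : i ∈ M) (h : Finset (Fin n) → ℝ)
    (hh : ∀ A ⊆ M.erase i, h (insert i A) = h A) :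
    ∑ A ∈ M.powerset, (-1 : ℝ) ^ A.card * h A = 0 := by
  have hM : M = insert i (M.erase i) := (Finset.insert_erase hi).symm
  rw [hM, Finset.sum_powerset_insert (Finset.notMem_erase i M), ← Finset.sum_add_distrib]
  refine Finset.sum_eq_zero fun A hA => ?_
  have hA' := Finset.mem_powerset.1 hA
  have hiA : i ∉ A := fun hc => Finset.notMem_erase i M (hA' hc)
  rw [hh A hA', Finset.card_insert_of_notMem hiA, pow_succ]
  ring

/-- A maximal monomial contains a sensitive block at every point. -/
lemma block_in_monomial {n : ℕ} {F : (Fin n → Bool) → ℝ} {c : Finset (Fin n) → ℝ}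
    (hF : F = ∑ S, c S • chi S) {M : Finset (Fin n)} (hM : c M ≠ 0) (hne : M.Nonempty)
    (hmax : ∀ S, M ⊂ S → c S = 0) (x : Fin n → Bool) :
    ∃ B ⊆ M, F (flip' x B) ≠ F x := by
  classical
  by_contra hcon
  push Not at hcon
  let pt : Finset (Fin n) → Fin n → Bool := fun A => ov M (fun i => decide (i ∈ A)) x
  have hpt : ∀ A, F (pt A) = F x := by
    intro A
    rw [← hcon (M.filter fun i => decide (i ∈ A) ≠ x i) (Finset.filter_subset _ _)]
    congr 1
    ext i
    by_cases h1 : i ∈ M <;> by_cases h2 : i ∈ A <;> cases h3 : x i <;> simp [pt, ov, flip', h1, h2, h3]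
  obtain ⟨i0, hi0⟩ := hne
  have hz : ∑ A ∈ M.powerset, (-1 : ℝ) ^ A.card * F (pt A) = 0 :=
    alt_sum_zero M i0 hi0 (fun A => F (pt A)) (fun A _ => by simp only [hpt])
  have hexp : ∀ A, F (pt A) = ∑ S, c S * chi S (pt A) := by
    intro A; rw [hF]; simp
  simp only [hexp, Finset.mul_sum] at hz
  rw [Finset.sum_comm, Finset.sum_eq_single M] at hz
  · rw [Finset.sum_eq_single M] at hz
    · have : chi M (pt M) = 1 := by
        rw [chi_apply, if_pos]
        intro i hi; simp [pt, ov, hi]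
      rw [this] at hz
      simp [hM] at hz
    · intro A hA hAM
      have : ∃ i ∈ M, i ∉ A := by
        by_contra hc
        push Not at hc
        exact hAM (Finset.Subset.antisymm (Finset.mem_powerset.1 hA) hc)
      obtain ⟨i, hi, hiA⟩ := this
      have : chi M (pt A) = 0 := by
        rw [chi_apply, if_neg]
        intro hc
        have := hc i hi
        simp [pt, ov, hi, hiA] at this
      rw [this]; simp
    · intro h; exact absurd (Finset.mem_powerset_self M) h
  · intro S _ hSM
    by_cases hsub : M ⊆ S
    · have := hmax S (Finset.ssubset_iff_subset_ne.2 ⟨hsub, fun h => hSM h.symm⟩)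
      simp [this]
    · obtain ⟨i, hi, hiS⟩ := Finset.not_subset.1 hsub
      refine alt_sum_zero M i hi (fun A => c S * chi S (pt A)) (fun A _ => ?_)
      congr 1
      unfold chi b2r
      refine Finset.prod_congr rfl fun j hj => ?_
      have hji : j ≠ i := fun h => hiS (h ▸ hj)
      simp [pt, ov, hji]
  · simp

/-- Indicator of a subcube. -/
noncomputable def ind {n : ℕ} (S : Finset (Fin n)) (a : Fin n → Bool) : (Fin n → Bool) → ℝ :=
  fun x => ∏ i ∈ S, (if a i then b2r x i else 1 - b2r x i)

lemma ind_apply {n : ℕ} (S : Finset (Fin n)) (a x : Fin n → Bool) :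
    ind S a x = if ∀ i ∈ S, x i = a i then 1 else 0 := by
  unfold ind b2r
  rw [show (if ∀ i ∈ S, x i = a i then (1:ℝ) else 0) = ∏ i ∈ S, if x i = a i then 1 else 0 by
    rw [Finset.prod_ite_zero]; simp]
  refine Finset.prod_congr rfl fun i _ => ?_
  cases x i <;> cases a i <;> simp

/-- Sums of indicators of subcubes of codimension at most `d`. -/
def LD (n d : ℕ) : AddSubmonoid ((Fin n → Bool) → ℝ) :=
  AddSubmonoid.closure {g | ∃ (S : Finset (Fin n)) (a : Fin n → Bool), S.card ≤ d ∧ g = ind S a}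

lemma LD_mul {n e : ℕ} (M : Finset (Fin n)) (a : Fin n → Bool) {g : (Fin n → Bool) → ℝ}
    (hg : g ∈ LD n e) {d : ℕ} (hd : M.card + e ≤ d) : ind M a * g ∈ LD n d := by
  classical
  induction hg using AddSubmonoid.closure_induction with
  | mem g hg =>
    obtain ⟨S, a', hS, rfl⟩ := hg
    by_cases hag : ∀ i ∈ M, i ∈ S → a i = a' i
    · have : ind M a * ind S a' = ind (M ∪ S) (ov M a a') := by
        ext x
        simp only [Pi.mul_apply, ind_apply]
        rw [ite_zero_mul_ite_zero, mul_one]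
        congr 1
        apply propext
        constructor
        · rintro ⟨h1, h2⟩ i hi
          by_cases hM : i ∈ M
          · simp [ov, hM, h1 i hM]
          · have : i ∈ S := by simpa [hM] using hi
            simp [ov, hM, h2 i this]
        · intro h
          refine ⟨fun i hi => ?_, fun i hi => ?_⟩
          · simpa [ov, hi] using h i (Finset.mem_union_left _ hi)
          · have := h i (Finset.mem_union_right _ hi)
            by_cases hM : i ∈ M
            · rw [this, ← hag i hM hi]; simp [ov, hM]
            · rw [this]; simp [ov, hM]
      rw [this]
      exact AddSubmonoid.subset_closure ⟨_, _, (Finset.card_union_le _ _).trans (by omega), rfl⟩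
    · push Not at hag
      obtain ⟨i, hM, hS', hne⟩ := hag
      have : ind M a * ind S a' = 0 := by
        ext x
        simp only [Pi.mul_apply, ind_apply, Pi.zero_apply]
        rw [ite_zero_mul_ite_zero, if_neg]
        rintro ⟨h1, h2⟩
        exact hne ((h1 i hM).symm.trans (h2 i hS'))
      rw [this]; exact zero_mem _
  | zero => rw [mul_zero]; exact zero_mem _
  | add a b _ _ ha hb => rw [mul_add]; exact add_mem ha hb

lemma const_LD {n d : ℕ} {F : (Fin n → Bool) → ℝ} (h01 : ∀ x, F x = 0 ∨ F x = 1)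
    (hc : ∀ x y, F x = F y) : F ∈ LD n d := by
  rcases h01 (fun _ => false) with h | h
  · have : F = 0 := by ext x; rw [hc x, h]; rfl
    rw [this]; exact zero_mem _
  · have : F = ind ∅ (fun _ => false) := by ext x; rw [hc x, h]; simp [ind]
    rw [this]; exact AddSubmonoid.subset_closure ⟨_, _, by simp, rfl⟩

lemma tree {n D : ℕ} (b : ℕ) : ∀ F : (Fin n → Bool) → ℝ, F ∈ PD n D →
    (∀ x, F x = 0 ∨ F x = 1) → (∀ x, ¬ HasBlocks F x (b + 1)) → F ∈ LD n (D * b) := by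
  classical
  induction b with
  | zero =>
    intro F _ h01 hb
    refine const_LD h01 fun x y => ?_
    by_contra hne
    refine hb x ⟨fun _ => Finset.univ.filter fun i => x i ≠ y i, ?_, ?_⟩
    · intro i j hij; exact absurd (Fin.ext (by omega)) hij
    · intro _
      have : flip' x (Finset.univ.filter fun i => x i ≠ y i) = y := by
        ext i
        cases h1 : x i <;> cases h2 : y i <;> simp [flip', h1, h2]
      rw [this]
      exact fun h => hne h.symm
  | succ b ih =>
    intro F hF h01 hb
    by_cases hconst : ∀ x y, F x = F y
    · exact const_LD h01 hconst
    obtain ⟨c, hcD, hc⟩ := PD_coeff hF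
    have hex : (Finset.univ.filter fun S : Finset (Fin n) => c S ≠ 0 ∧ S.Nonempty).Nonempty := by
      by_contra hemp
      rw [Finset.not_nonempty_iff_eq_empty, Finset.filter_eq_empty_iff] at hemp
      apply hconst
      have hcE : F = c ∅ • chi ∅ := by
        rw [hc]
        refine Finset.sum_eq_single ∅ (fun S _ hS => ?_) (by simp)
        have : c S = 0 := by
          by_contra h
          exact hemp (Finset.mem_univ S) ⟨h, Finset.nonempty_iff_ne_empty.2 hS⟩
        rw [this, zero_smul]
      intro x y
      rw [hcE]; simp [chi]
    obtain ⟨M, hMmem, hMmax⟩ := Finset.exists_max_image _ Finset.card hex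
    simp only [Finset.mem_filter, Finset.mem_univ, true_and] at hMmem hMmax
    obtain ⟨hM, hMne⟩ := hMmem
    have hmax : ∀ S, M ⊂ S → c S = 0 := by
      intro S hS
      by_contra h
      have h1 := hMmax S ⟨h, hMne.mono hS.1⟩
      have h2 := Finset.card_lt_card hS
      omega
    have hsum : F = ∑ A ∈ M.powerset, ind M (fun i => decide (i ∈ A)) *
        (fun x => F (ov M (fun i => decide (i ∈ A)) x)) := by
      ext x
      rw [Finset.sum_apply, Finset.sum_eq_single (M.filter fun i => x i = true)]
      · simp only [Pi.mul_apply, ind_apply]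
        rw [if_pos (by intro i hi; simp [hi]), one_mul]
        congr 1
        ext i
        by_cases hi : i ∈ M <;> simp [ov, hi]
      · intro A hA hne
        simp only [Pi.mul_apply, ind_apply]
        rw [if_neg, zero_mul]
        intro h
        apply hne
        ext i
        rw [Finset.mem_filter]
        constructor
        · intro hi
          have hiM := Finset.mem_powerset.1 hA hi
          exact ⟨hiM, by simp [h i hiM, hi]⟩
        · rintro ⟨hiM, hx⟩
          have := h i hiM
          rw [hx] at this
          simpa using this
      · intro h
        exact absurd (Finset.mem_powerset.2 (Finset.filter_subset _ _)) h
    rw [hsum]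
    refine sum_mem fun A _ => LD_mul M _ (ih _ ?_ ?_ ?_) (e := D * b) ?_
    · refine PD_comp hF _ fun i => ?_
      by_cases hi : i ∈ M
      · have : (fun y => b2r (ov M (fun i => decide (i ∈ A)) y) i) =
            (b2r (fun i => decide (i ∈ A)) i) • (1 : (Fin n → Bool) → ℝ) := by
          ext y; simp [b2r, ov, hi]
        rw [this]; exact Submodule.smul_mem _ _ one_mem_PD
      · have : (fun y => b2r (ov M (fun i => decide (i ∈ A)) y) i) = fun y => b2r y i := by
          ext y; simp [b2r, ov, hi]
        rw [this]; exact coord_mem i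
    · exact fun x => h01 _
    · rintro x ⟨B, hdis, hsens⟩
      obtain ⟨B0, hB0, hs0⟩ := block_in_monomial hc hM hMne hmax (ov M (fun i => decide (i ∈ A)) x)
      refine hb (ov M (fun i => decide (i ∈ A)) x) ⟨Fin.cons B0 (fun i => B i \ M), ?_, ?_⟩
      · intro i j hij
        have hd0 : ∀ i, Disjoint B0 (B i \ M) := fun i =>
          Finset.disjoint_left.2 fun k hk hk' => (Finset.mem_sdiff.1 hk').2 (hB0 hk)
        rcases Fin.eq_zero_or_eq_succ i with rfl | ⟨i, rfl⟩ <;>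
          rcases Fin.eq_zero_or_eq_succ j with rfl | ⟨j, rfl⟩
        · exact absurd rfl hij
        · simpa using hd0 j
        · simpa using (hd0 i).symm
        · have hij' : i ≠ j := fun h => hij (by rw [h])
          simp only [Fin.cons_succ]
          exact (hdis i j hij').mono Finset.sdiff_subset Finset.sdiff_subset
      · intro i
        refine Fin.cases ?_ (fun i => ?_) i
        · simpa using hs0
        · have : flip' (ov M (fun i => decide (i ∈ A)) x) (B i \ M) =
              ov M (fun i => decide (i ∈ A)) (flip' x (B i)) := by
            ext k
            by_cases h1 : k ∈ M <;> by_cases h2 : k ∈ B i <;> simp [flip', ov, h1, h2]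
          simp only [Fin.cons_succ]
          rw [this]
          exact hsens i
    · have := hcD M hM
      rw [Nat.mul_succ]; omega

lemma LD_hasLitDeg {n d : ℕ} {F : (Fin n → Bool) → ℝ} (hF : F ∈ LD n d) : HasLitDeg n d F := by
  induction hF using AddSubmonoid.closure_induction with
  | mem g hg =>
    obtain ⟨S, a, hS, rfl⟩ := hg
    exact ⟨1, fun _ => 1, fun _ => S, fun _ => a, by simp, by simpa using hS, by simp [ind]⟩
  | zero => exact ⟨0, fun _ => 0, fun _ => ∅, fun _ _ => false, by simp, by simp, by simp⟩
  | add f g _ _ hf hg =>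
    obtain ⟨m, α, S, a, h1, h2, h3⟩ := hf
    obtain ⟨m', α', S', a', h1', h2', h3'⟩ := hg
    refine ⟨m + m', Fin.append α α', Fin.append S S', Fin.append a a', ?_, ?_, ?_⟩
    · intro j
      refine Fin.addCases (fun i => ?_) (fun i => ?_) j
      · simpa using h1 i
      · simpa using h1' i
    · intro j
      refine Fin.addCases (fun i => ?_) (fun i => ?_) j
      · simpa using h2 i
      · simpa using h2' i
    · intro x
      rw [Fin.sum_univ_add]
      simp [h3, h3']

lemma exists_sosDeg (n : ℕ) (f : (Fin n → Bool) → ℝ) (hf : ∀ x, f x = 0 ∨ f x = 1) :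
    ∃ d, HasSosDeg n d f := by
  let p : MvPolynomial (Fin n) ℝ := ∑ a : Fin n → Bool, MvPolynomial.C (f a) *
    ∏ i, (if a i then MvPolynomial.X i else 1 - MvPolynomial.X i)
  refine ⟨p.totalDegree, 1, fun _ => p, by simp, fun x => ?_⟩
  have h : MvPolynomial.eval (b2r x) p = f x := by
    have h1 : MvPolynomial.eval (b2r x) p = ∑ a : Fin n → Bool, f a * ind Finset.univ a x := by
      simp only [p, map_sum, map_mul, MvPolynomial.eval_C, map_prod, ind]
      refine Finset.sum_congr rfl fun a _ => ?_
      congr 1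
      refine Finset.prod_congr rfl fun i _ => ?_
      split_ifs <;> simp
    rw [h1, Finset.sum_eq_single x]
    · simp [ind_apply]
    · intro a _ hne
      rw [ind_apply, if_neg, mul_zero]
      intro hc
      exact hne (funext fun i => (hc i (Finset.mem_univ i)).symm)
    · simp
  simp only [h, Finset.univ_unique, Finset.sum_const, Finset.card_singleton, one_smul]
  rcases hf x with h | h <;> simp [h]

/-- For Boolean-valued `f`, `ldeg₊(f) ≤ 16 · deg_sos(f)³`. -/
theorem ldegPos_le_cube_degSos (n : ℕ) (f : (Fin n → Bool) → ℝ)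
    (hf : ∀ x, f x = 0 ∨ f x = 1) :
    ldegPos n f ≤ 16 * (degSos n f) ^ 3 := by
  have hmem : HasSosDeg n (degSos n f) f := Nat.sInf_mem (s := {d | HasSosDeg n d f})
    (exists_sosDeg n f hf)
  generalize degSos n f = d at hmem
  obtain ⟨m, p, hdeg, hp⟩ := hmem
  have hP : f ∈ PD n (2 * d) := by
    have : f = ∑ i, (fun x => MvPolynomial.eval (b2r x) (p i)) ^ 2 := by
      ext x; rw [hp x]; simp
    rw [this]
    exact sum_mem fun i _ => PD_pow (eval_mem_PD (p i) (hdeg i)) 2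
  have hT := tree ((2 * d) ^ 2) f hP hf (fun x hb => by
    have := blocks_le hP hf hb
    omega)
  have hle : ldegPos n f ≤ 2 * d * (2 * d) ^ 2 := Nat.sInf_le (LD_hasLitDeg hT)
  have : 2 * d * (2 * d) ^ 2 = 8 * d ^ 3 := by ring
  omega
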